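/- arXiv:2205.05125 — 3 statements merged into one kernel-verified Lean document; each statement's English description precedes it below -/
import Mathlib

section
/- Suppose j is a join-irreducible element of W with cov(j) = {t}. Then Sh(j) = β_t^⊥ if and only if j is a simple reflection. -/
open scoped BigOperators Pointwise

noncomputable section

namespace PaperScat

/-- The ambient vector space `V`, coordinatized in the basis of simple roots.
We also use `V n` for the dual space `V*`, coordinatized by the values on the
simple roots, so that the pairing `⟨x, v⟩` becomes `pairing x v` below. -/
abbrev V (n : ℕ) := Fin n → ℝ

/-- The simple root `α_i` (a standard basis vector). -/
def α {n : ℕ} (i : Fin n) : V n := Pi.single i 1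

/-- The pairing `⟨·,·⟩ : V* × V → ℝ`. -/
def pairing {n : ℕ} (x v : V n) : ℝ := ∑ i, x i * v i

/-- The fundamental domain `D = {x ∈ V* : ⟨x, α_i⟩ ≥ 0 ∀ i}`. -/
def fundD (n : ℕ) : Set (V n) := {x | ∀ i, 0 ≤ x i}

/-- `F` is a face of the convex cone `C`. -/
def IsFaceOf {E : Type*} [AddCommGroup E] [Module ℝ E] (F C : Set E) : Prop :=
  F ⊆ C ∧ ∀ x ∈ C, ∀ y ∈ C, ∀ z ∈ F, z ∈ segment ℝ x y → z ≠ x → z ≠ y → segment ℝ x y ⊆ F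

/-- The relative interior of a cone: its interior within its linear span. -/
def relint {E : Type*} [AddCommGroup E] [Module ℝ E] [TopologicalSpace E] (s : Set E) :
    Set E :=
  Subtype.val '' interior {x : ↥(Submodule.span ℝ s) | (x : E) ∈ s}

/-- Projection `Proj_I : V* → V_I*` (restriction of coordinates). -/
def projI {n : ℕ} (I : Finset (Fin n)) (x : V n) : {i : Fin n // i ∈ I} → ℝ := fun i => x i.1

/-- The pairing between `V_I*` and `V_I`. -/
def pairingI {n : ℕ} (I : Finset (Fin n)) (x : {i : Fin n // i ∈ I} → ℝ) (v : V n) : ℝ :=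
  ∑ i, x i * v i.1

/-- The fundamental domain `D_I ⊆ V_I*`. -/
def fundDI {n : ℕ} (I : Finset (Fin n)) : Set ({i : Fin n // i ∈ I} → ℝ) := {x | ∀ i, 0 ≤ x i}


/-- Pull back a dual vector along `w`; this is `w⁻¹ · x` for the dual action. -/
def pullback {n : ℕ} (w : Module.End ℝ (V n)) (x : V n) : V n :=
  fun j => pairing x (w (α j))

/-- The cone `wD ⊆ V*`. -/
def chamber {n : ℕ} (w : Module.End ℝ (V n)) : Set (V n) := {x | pullback w x ∈ fundD n}

/-- Pull back along `w` in `V_I*`. -/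
def pullbackI {n : ℕ} (I : Finset (Fin n)) (w : Module.End ℝ (V n))
    (x : {i : Fin n // i ∈ I} → ℝ) : {i : Fin n // i ∈ I} → ℝ :=
  fun j => pairingI I x (w (α j.1))

/-- The cone `wD_I ⊆ V_I*` for `w ∈ W_I`. -/
def chamberI {n : ℕ} (I : Finset (Fin n)) (w : Module.End ℝ (V n)) :
    Set ({i : Fin n // i ∈ I} → ℝ) :=
  {x | pullbackI I w x ∈ fundDI I}

/-- The cone `{x ∈ V* : ⟨x, β⟩ ≥ 0 ∀ β ∈ X}`. -/
def dualCone {n : ℕ} (X : Set (V n)) : Set (V n) := {x | ∀ β ∈ X, 0 ≤ pairing x β}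

/-- The cone `{x ∈ V_I* : ⟨x, β⟩ ≥ 0 ∀ β ∈ X}`. -/
def dualConeI {n : ℕ} (I : Finset (Fin n)) (X : Set (V n)) :
    Set ({i : Fin n // i ∈ I} → ℝ) :=
  {x | ∀ β ∈ X, 0 ≤ pairingI I x β}

/-- A symmetrizable generalized Cartan matrix together with its symmetrizers. -/
structure Setup (n : ℕ) where
  A : Matrix (Fin n) (Fin n) ℤ
  d : Fin n → ℝ
  diag : ∀ i, A i i = 2
  offdiag_nonpos : ∀ i j, i ≠ j → A i j ≤ 0
  zero_iff : ∀ i j, A i j = 0 ↔ A j i = 0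
  d_pos : ∀ i, 0 < d i
  dsymm : ∀ i j, d i * (A i j : ℝ) = d j * (A j i : ℝ)

namespace Setup

variable {n : ℕ} (S : Setup n)

/-- The symmetric bilinear form `K`, with `K(α_i, α_j) = d_i a_{ij}`,
so `K(α_i^∨, α_j) = a_{ij}`. -/
def K (x y : V n) : ℝ := ∑ p, ∑ q, x p * (S.d p * (S.A p q : ℝ)) * y q

/-- The linear functional `v ↦ K(α_i^∨, v) = ∑_j a_{ij} v_j`. -/
def coefL (i : Fin n) : V n →ₗ[ℝ] ℝ :=
  ∑ j, (S.A i j : ℝ) • (LinearMap.proj j : V n →ₗ[ℝ] ℝ)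

/-- The simple reflection `s_i : v ↦ v − K(α_i^∨, v) α_i`. -/
def sRefl (i : Fin n) : Module.End ℝ (V n) :=
  (LinearMap.id : V n →ₗ[ℝ] V n) - (S.coefL i).smulRight (α i)

/-- The Coxeter group `W` generated by the simple reflections (as a submonoid of
linear endomorphisms of `V`; it is a group since the generators are involutions). -/
def W : Submonoid (Module.End ℝ (V n)) := Submonoid.closure (Set.range S.sRefl)

/-- The standard parabolic subgroup `W_I`. -/
def WI (I : Finset (Fin n)) : Submonoid (Module.End ℝ (V n)) :=
  Submonoid.closure (S.sRefl '' (I : Set (Fin n)))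

/-- The real roots `Φ^re`. -/
def realRoots : Set (V n) := {β | ∃ w ∈ S.W, ∃ i, β = w (α i)}

/-- The positive (real) roots `Φ⁺`. -/
def posRoots : Set (V n) := {β | β ∈ S.realRoots ∧ ∀ i, 0 ≤ β i}

/-- The inversion set of `w`. -/
def inversions (w : Module.End ℝ (V n)) : Set (V n) :=
  {β | β ∈ S.posRoots ∧ -(w β) ∈ S.posRoots}

/-- Weak order. -/
def wle (v w : Module.End ℝ (V n)) : Prop := S.inversions v ⊆ S.inversions w

/-- Strict weak order. -/
def wlt (v w : Module.End ℝ (V n)) : Prop := S.inversions v ⊂ S.inversions w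

/-- `v` is covered by `w` in the weak order on `W`. -/
def WCovBy (v w : Module.End ℝ (V n)) : Prop :=
  v ∈ S.W ∧ w ∈ S.W ∧ S.wlt v w ∧ ∀ u ∈ S.W, ¬ (S.wlt v u ∧ S.wlt u w)

/-- `j` is join-irreducible: it covers exactly one element. -/
def JoinIrr (j : Module.End ℝ (V n)) : Prop :=
  j ∈ S.W ∧ ∃! v, S.WCovBy v j

/-- `jstar` is the unique lower cover of the join-irreducible `j` and `β` is the
positive root of the unique cover reflection, i.e. `cov(j) = {t_β}`. -/
def CoverData (j jstar : Module.End ℝ (V n)) (β : V n) : Prop :=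
  S.WCovBy jstar j ∧ β ∈ S.posRoots ∧
    S.inversions j = S.inversions jstar ∪ {β}

/-- The reflection `t_β : v ↦ v − (2 K(β,v)/K(β,β)) β` associated to a root `β`. -/
def tRefl (β : V n) (v : V n) : V n := v - ((2 * S.K β v) / S.K β β) • β

/-- The rank-2 subsystem of `Φ` containing `β` and `γ`. -/
def sub2 (β γ : V n) : Set (V n) :=
  S.realRoots ∩ ((Submodule.span ℝ ({β, γ} : Set (V n)) : Submodule ℝ (V n)) : Set (V n))

/-- `p, q` is the canonical pair of roots of the rank-2 subsystem `Φ'`: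
the (unique) pair of roots of `Φ'` whose nonnegative span contains `Φ' ∩ Φ⁺`. -/
def IsCanonicalPair (Φ' : Set (V n)) (p q : V n) : Prop :=
  p ∈ Φ' ∧ q ∈ Φ' ∧
    ∀ v ∈ Φ' ∩ S.posRoots, ∃ a b : ℝ, 0 ≤ a ∧ 0 ≤ b ∧ v = a • p + b • q

/-- `p` is a canonical root of the rank-2 subsystem `Φ'`. -/
def IsCanonicalRoot (Φ' : Set (V n)) (p : V n) : Prop :=
  ∃ q, S.IsCanonicalPair Φ' p q

/-- `γ` cuts `β`. -/
def Cuts (γ β : V n) : Prop :=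
  γ ∈ S.posRoots ∧ β ∈ S.posRoots ∧ γ ≠ β ∧
    S.IsCanonicalRoot (S.sub2 β γ) γ ∧ ¬ S.IsCanonicalRoot (S.sub2 β γ) β

/-- `cut(β)`. -/
def cutSet (β : V n) : Set (V n) := {γ | S.Cuts γ β}

/-- The Tits cone. -/
def Tits : Set (V n) := ⋃ w ∈ S.W, chamber w

/-- The hyperplane `β^⊥` minus the cutting hyperplanes. -/
def shardGround (β : V n) : Set (V n) :=
  {x | pairing x β = 0 ∧ ∀ γ ∈ S.cutSet β, pairing x γ ≠ 0}

/-- `Z` is a shard in the hyperplane `β^⊥`: the closure of a connected component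
of `β^⊥ ∖ ⋃_{γ ∈ cut(β)} γ^⊥`. -/
def IsShardIn (β : V n) (Z : Set (V n)) : Prop :=
  ∃ x ∈ S.shardGround β, Z = closure (connectedComponentIn (S.shardGround β) x)

/-- The set of upper elements of a shard `Z ⊆ β^⊥`. -/
def Upper (β : V n) (Z : Set (V n)) : Set (Module.End ℝ (V n)) :=
  {w | w ∈ S.W ∧
    Module.finrank ℝ ↥(Submodule.span ℝ (chamber w ∩ Z)) = n - 1 ∧
    β ∈ S.inversions w}

/-- `l` is a reduced word (a duplicate-free list with support `I`) for the
Coxeter element `c` of `W_I`. -/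
def IsWordOf (I : Finset (Fin n)) (l : List (Fin n)) (c : Module.End ℝ (V n)) : Prop :=
  l.Nodup ∧ l.toFinset = I ∧ c = (l.map S.sRefl).prod

/-- `l` is a reduced word for the Coxeter element `c` of `W`. -/
def IsCoxWord (l : List (Fin n)) (c : Module.End ℝ (V n)) : Prop :=
  S.IsWordOf Finset.univ l c

/-- `s_i` is initial in the Coxeter element `c` of `W_I`. -/
def Initial (I : Finset (Fin n)) (c : Module.End ℝ (V n)) (i : Fin n) : Prop :=
  ∃ l, S.IsWordOf I l c ∧ l.head? = some i

/-- Matrix entry of `ω_c` on the simple root basis, for `c` given by the word `l`. -/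
def omegaEntry (l : List (Fin n)) (p q : Fin n) : ℝ :=
  if l.idxOf q < l.idxOf p then S.d p * (S.A p q : ℝ)
  else if l.idxOf p < l.idxOf q then -(S.d p * (S.A p q : ℝ))
  else 0

/-- The skew-symmetric bilinear form `ω_c`, with `ω_c(α_i^∨, α_j) = a_{ij}` if `i > j`,
`0` if `i = j`, `−a_{ij}` if `i < j` (ordering given by the word `l` for `c`). -/
def omega (l : List (Fin n)) (x y : V n) : ℝ :=
  ∑ p, ∑ q, x p * S.omegaEntry l p q * y q

/-- The functional `ω_c(·, β) ∈ V*` (in coordinates `j ↦ ω_c(α_j, β)`). -/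
def omegaFun (l : List (Fin n)) (β : V n) : V n := fun j => S.omega l (α j) β

/-- Matrix entry of `E_c` on the simple root basis. -/
def EcEntry (l : List (Fin n)) (p q : Fin n) : ℝ :=
  if l.idxOf q < l.idxOf p then S.d p * (S.A p q : ℝ)
  else if l.idxOf p < l.idxOf q then 0
  else S.d p

/-- The bilinear form `E_c`, with `E_c(α_i^∨, α_j) = a_{ij}` if `i > j`, `1` if `i = j`,
`0` if `i < j`. -/
def Ec (l : List (Fin n)) (x y : V n) : ℝ :=
  ∑ p, ∑ q, x p * S.EcEntry l p q * y q

/-- `ν_c(β) = −E_c(·, β)` for `β` in the nonnegative span of the simple roots. -/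
def nuPos (l : List (Fin n)) (β : V n) : V n := fun j => -(S.Ec l (α j) β)

/-- `A` (equivalently `K`) is positive semidefinite. -/
def PosSemidef : Prop := ∀ v : V n, 0 ≤ S.K v v

/-- `A` (equivalently `K`) is positive definite: finite type. -/
def PosDef : Prop := ∀ v : V n, v ≠ 0 → 0 < S.K v v

/-- Every proper principal minor of `A` is positive. -/
def ProperMinorsPos : Prop :=
  ∀ I : Finset (Fin n), I ≠ Finset.univ →
    0 < (S.A.submatrix (fun i : {x : Fin n // x ∈ I} => (i : Fin n))
          (fun i : {x : Fin n // x ∈ I} => (i : Fin n))).det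

/-- `A` is of affine type. -/
def AffineType : Prop := S.PosSemidef ∧ S.ProperMinorsPos

/-- `δ` is the unique primitive positive imaginary root: it spans the radical of `K`
and has positive coprime integer coordinates. -/
def IsDelta (δ : V n) : Prop :=
  (∀ v, S.K δ v = 0) ∧
  (∃ m : Fin n → ℕ, (∀ i, δ i = (m i : ℝ)) ∧ (∀ i, 0 < m i) ∧ Finset.univ.gcd m = 1) ∧
  (∀ v : V n, (∀ u, S.K v u = 0) → ∃ r : ℝ, v = r • δ)

/-- The subgroup of translations: elements of `W` acting trivially modulo `ℝδ`. -/
def Translations (δ : V n) : Set (Module.End ℝ (V n)) :=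
  {w | w ∈ S.W ∧ ∀ v, ∃ r : ℝ, w v = v + r • δ}

/-- `aff` is an affine index: `W` is the semidirect product of
`W_fin = W_{⟨s_aff⟩}` with the translation lattice. -/
def IsAffIndex (δ : V n) (aff : Fin n) : Prop :=
  (∀ w ∈ S.W, ∃ u ∈ S.WI (Finset.univ.erase aff), ∃ t ∈ S.Translations δ, w = u * t) ∧
  (∀ w ∈ S.WI (Finset.univ.erase aff), w ∈ S.Translations δ → w = 1)

/-- The imaginary wall `d_∞ = {x ∈ ∂Tits(A) : ⟨x,β⟩ ≤ 0 ∀ β ∈ Φ_fin^{ω+}}`. -/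
def dInf (l : List (Fin n)) (δ : V n) (aff : Fin n) : Set (V n) :=
  {x | pairing x δ = 0 ∧
    ∀ β, β ∈ S.realRoots → β aff = 0 → 0 < S.omega l β δ → pairing x β ≤ 0}

/-- `Υ^re_c`: the union of the `c`-orbits of the positive roots in `Φ ∩ V(c) ∩ V_fin`. -/
def UpsRe (c : Module.End ℝ (V n)) (γc : V n) (aff : Fin n) : Set (V n) :=
  {β | ∃ γ, γ ∈ S.posRoots ∧ S.K γc γ = 0 ∧ γ aff = 0 ∧ ∃ k : ℕ, β = (c ^ k) γ}

/-- The real almost positive Schur roots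
`AP^re(c) = −Δ ∪ (Φ⁺ ∖ V(c)) ∪ Υ^re_c`. -/
def APre (c : Module.End ℝ (V n)) (γc : V n) (aff : Fin n) : Set (V n) :=
  {β | ∃ i, β = -(α i)} ∪ {β | β ∈ S.posRoots ∧ S.K γc β ≠ 0} ∪ S.UpsRe c γc aff

/-- The complement of the cutting hyperplanes inside `β^⊥ ⊆ V_I*`. -/
def shardGroundI (I : Finset (Fin n)) (β : V n) : Set ({i : Fin n // i ∈ I} → ℝ) :=
  {x | pairingI I x β = 0 ∧
    ∀ γ ∈ S.cutSet β, (∀ j, j ∉ I → γ j = 0) → pairingI I x γ ≠ 0}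

/-- `Z` is a shard of the parabolic root system `Φ_I` in `β^⊥ ⊆ V_I*`. -/
def IsShardInI (I : Finset (Fin n)) (β : V n) (Z : Set ({i : Fin n // i ∈ I} → ℝ)) : Prop :=
  ∃ x ∈ S.shardGroundI I β, Z = closure (connectedComponentIn (S.shardGroundI I β) x)

/-- Cover relation in the weak order on `W_I`. -/
def WCovByI (I : Finset (Fin n)) (v w : Module.End ℝ (V n)) : Prop :=
  v ∈ S.WI I ∧ w ∈ S.WI I ∧ S.wlt v w ∧ ∀ u ∈ S.WI I, ¬ (S.wlt v u ∧ S.wlt u w)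

/-- Join-irreducibility in `W_I`. -/
def JoinIrrI (I : Finset (Fin n)) (j : Module.End ℝ (V n)) : Prop :=
  j ∈ S.WI I ∧ ∃! v, S.WCovByI I v j

end Setup

/-- `Sortable S I c v`: `v` is a `c`-sortable element of `W_I` (recursive definition). -/
inductive Sortable {n : ℕ} (S : Setup n) :
    Finset (Fin n) → Module.End ℝ (V n) → Module.End ℝ (V n) → Prop
  | one (I : Finset (Fin n)) (c : Module.End ℝ (V n)) : Sortable S I c 1
  | up {I : Finset (Fin n)} {c : Module.End ℝ (V n)} {i : Fin n}
      {v : Module.End ℝ (V n)} :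
      i ∈ I → S.Initial I c i → S.wle (S.sRefl i) v →
      Sortable S I (S.sRefl i * c * S.sRefl i) (S.sRefl i * v) → Sortable S I c v
  | para {I : Finset (Fin n)} {c : Module.End ℝ (V n)} {i : Fin n}
      {v : Module.End ℝ (V n)} :
      i ∈ I → S.Initial I c i → ¬ S.wle (S.sRefl i) v →
      v ∈ S.WI (I.erase i) → Sortable S (I.erase i) (S.sRefl i * c) v → Sortable S I c v

/-- `CSet S I c v X`: `X = C_c(v)`, the set of roots defining the Cambrian cone of the
`c`-sortable element `v` of `W_I` (recursive definition). -/
inductive CSet {n : ℕ} (S : Setup n) :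
    Finset (Fin n) → Module.End ℝ (V n) → Module.End ℝ (V n) → Set (V n) → Prop
  | one (I : Finset (Fin n)) (c : Module.End ℝ (V n)) :
      CSet S I c 1 {β | ∃ i ∈ I, β = α i}
  | up {I : Finset (Fin n)} {c : Module.End ℝ (V n)} {i : Fin n}
      {v : Module.End ℝ (V n)} {X : Set (V n)} :
      i ∈ I → S.Initial I c i → S.wle (S.sRefl i) v →
      CSet S I (S.sRefl i * c * S.sRefl i) (S.sRefl i * v) X →
      CSet S I c v ((S.sRefl i) '' X)
  | para {I : Finset (Fin n)} {c : Module.End ℝ (V n)} {i : Fin n}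
      {v : Module.End ℝ (V n)} {X : Set (V n)} :
      i ∈ I → S.Initial I c i → ¬ S.wle (S.sRefl i) v →
      v ∈ S.WI (I.erase i) → CSet S (I.erase i) (S.sRefl i * c) v X →
      CSet S I c v (X ∪ {α i})

namespace Setup

variable {n : ℕ} (S : Setup n)

/-- `C = Cone_c(v)` for a `c`-sortable element `v`: a maximal cone of the Cambrian fan. -/
def IsCambMaxCone (c : Module.End ℝ (V n)) (C : Set (V n)) : Prop :=
  ∃ v X, Sortable S Finset.univ c v ∧ CSet S Finset.univ c v X ∧ C = dualCone X

/-- `F` is a cone (face) of the `c`-Cambrian fan. -/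
def IsCambCone (c : Module.End ℝ (V n)) (F : Set (V n)) : Prop :=
  ∃ C, S.IsCambMaxCone c C ∧ IsFaceOf F C

/-- Maximal cones of the parabolic Cambrian fan in `V_I*`. -/
def IsCambMaxConeI (I : Finset (Fin n)) (c' : Module.End ℝ (V n))
    (C : Set ({i : Fin n // i ∈ I} → ℝ)) : Prop :=
  ∃ v X, Sortable S I c' v ∧ CSet S I c' v X ∧ C = dualConeI I X

/-- Cones (faces) of the parabolic Cambrian fan in `V_I*`. -/
def IsCambConeI (I : Finset (Fin n)) (c' : Module.End ℝ (V n))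
    (F : Set ({i : Fin n // i ∈ I} → ℝ)) : Prop :=
  ∃ C, S.IsCambMaxConeI I c' C ∧ IsFaceOf F C

/-- Maximal cones of the doubled Cambrian fan `DF_c = F_c ∪ (−F_{c⁻¹})`. -/
def IsDCambMaxCone (c cinv : Module.End ℝ (V n)) (C : Set (V n)) : Prop :=
  S.IsCambMaxCone c C ∨ ∃ D, S.IsCambMaxCone cinv D ∧ C = -D

/-- Cones (faces) of the doubled Cambrian fan. -/
def IsDCambCone (c cinv : Module.End ℝ (V n)) (F : Set (V n)) : Prop :=
  ∃ C, S.IsDCambMaxCone c cinv C ∧ IsFaceOf F C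

end Setup

namespace Setup

variable {n : ℕ} (S : Setup n)

/-- product of a word -/
def wp (l : List (Fin n)) : Module.End ℝ (V n) := (l.map S.sRefl).prod

lemma wp_nil : S.wp [] = 1 := rfl

lemma wp_cons (p : Fin n) (l : List (Fin n)) : S.wp (p :: l) = S.sRefl p * S.wp l := by
  simp [wp]

lemma wp_append (l m : List (Fin n)) : S.wp (l ++ m) = S.wp l * S.wp m := by
  simp [wp]

lemma wp_single (p : Fin n) : S.wp [p] = S.sRefl p := by simp [wp]

lemma wp_mem (l : List (Fin n)) : S.wp l ∈ S.W := by
  unfold wp W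
  apply Submonoid.list_prod_mem
  intro x hx
  obtain ⟨p, _, rfl⟩ := List.mem_map.1 hx
  exact Submonoid.subset_closure ⟨p, rfl⟩

lemma exists_wp {w : Module.End ℝ (V n)} (hw : w ∈ S.W) : ∃ l, S.wp l = w := by
  unfold W at hw
  induction hw using Submonoid.closure_induction with
  | mem x hx => obtain ⟨p, rfl⟩ := hx; exact ⟨[p], S.wp_single p⟩
  | one => exact ⟨[], rfl⟩
  | mul x y _ _ hx hy =>
    obtain ⟨a, rfl⟩ := hx
    obtain ⟨b, rfl⟩ := hy
    exact ⟨a ++ b, S.wp_append a b⟩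

lemma sRefl_mem (i : Fin n) : S.sRefl i ∈ S.W := Submonoid.subset_closure ⟨i, rfl⟩

lemma alpha_apply (i k : Fin n) : (α i : V n) k = if k = i then 1 else 0 := by
  simp [α, Pi.single_apply]

lemma coefL_apply (i : Fin n) (v : V n) : S.coefL i v = ∑ j, (S.A i j : ℝ) * v j := by
  simp [coefL]

lemma coefL_alpha (i : Fin n) : S.coefL i (α i) = 2 := by
  simp [coefL_apply, alpha_apply, S.diag]

lemma sRefl_apply (i : Fin n) (v : V n) : S.sRefl i v = v - S.coefL i v • α i := by
  simp [sRefl]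

lemma sRefl_alpha (i : Fin n) : S.sRefl i (α i) = -α i := by
  rw [sRefl_apply, coefL_alpha]; module

lemma sRefl_apply_ne (i k : Fin n) (h : k ≠ i) (v : V n) : S.sRefl i v k = v k := by
  simp [sRefl_apply, alpha_apply, h]

lemma sRefl_sq (i : Fin n) : S.sRefl i * S.sRefl i = 1 := by
  apply LinearMap.ext
  intro v
  simp only [Module.End.mul_apply, Module.End.one_apply]
  rw [S.sRefl_apply i v, map_sub, map_smul, sRefl_alpha, sRefl_apply]
  module

lemma sRefl_sRefl (i : Fin n) (v : V n) : S.sRefl i (S.sRefl i v) = v := by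
  have := congrArg (fun f => f v) (S.sRefl_sq i)
  simpa using this

lemma wp_reverse (l : List (Fin n)) : S.wp l.reverse * S.wp l = 1 := by
  induction l with
  | nil => simp [wp_nil]
  | cons p l ih =>
    rw [List.reverse_cons, wp_append, wp_single, wp_cons, mul_assoc, ← mul_assoc (S.sRefl p),
      sRefl_sq, one_mul, ih]

lemma wp_reverse' (l : List (Fin n)) : S.wp l * S.wp l.reverse = 1 := by
  have := S.wp_reverse l.reverse
  simpa using this

lemma wp_rev_apply (l : List (Fin n)) (v : V n) : S.wp l.reverse (S.wp l v) = v := by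
  have := congrArg (fun f => f v) (S.wp_reverse l)
  simpa using this

lemma wp_inj (l : List (Fin n)) : Function.Injective (S.wp l) :=
  Function.LeftInverse.injective (S.wp_rev_apply l)

/-! form -/

lemma K_symm (x y : V n) : S.K x y = S.K y x := by
  unfold K
  rw [Finset.sum_comm]
  refine Finset.sum_congr rfl fun p _ => Finset.sum_congr rfl fun q _ => ?_
  rw [S.dsymm q p]; ring

lemma K_alpha_left (i : Fin n) (y : V n) : S.K (α i) y = S.d i * S.coefL i y := by
  unfold K
  rw [Finset.sum_eq_single i]
  · rw [coefL_apply, Finset.mul_sum]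
    refine Finset.sum_congr rfl fun q _ => ?_
    simp [alpha_apply]; ring
  · intro b _ hb
    simp [alpha_apply, hb]
  · simp

lemma K_sub_smul_left (x y z : V n) (c : ℝ) : S.K (x - c • y) z = S.K x z - c * S.K y z := by
  unfold K
  simp only [Finset.mul_sum, ← Finset.sum_sub_distrib]
  refine Finset.sum_congr rfl fun p _ => Finset.sum_congr rfl fun q _ => ?_
  simp; ring

lemma K_sub_smul_right (x y z : V n) (c : ℝ) : S.K z (x - c • y) = S.K z x - c * S.K z y := by
  rw [K_symm, K_sub_smul_left, K_symm, S.K_symm y]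

lemma K_sRefl (i : Fin n) (x y : V n) : S.K (S.sRefl i x) (S.sRefl i y) = S.K x y := by
  rw [sRefl_apply, sRefl_apply, K_sub_smul_left, K_sub_smul_right, K_sub_smul_right,
    K_alpha_left, K_alpha_left, coefL_alpha, S.K_symm x (α i), K_alpha_left]
  ring

lemma K_wp (l : List (Fin n)) (x y : V n) : S.K (S.wp l x) (S.wp l y) = S.K x y := by
  induction l with
  | nil => simp [wp_nil]
  | cons p l ih => rw [wp_cons, Module.End.mul_apply, Module.End.mul_apply, K_sRefl, ih]

lemma K_alpha_alpha (i : Fin n) : S.K (α i) (α i) = 2 * S.d i := by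
  rw [K_alpha_left, coefL_alpha]; ring

lemma conj (l : List (Fin n)) (i p : Fin n) (h : S.wp l (α i) = α p) :
    S.sRefl p * S.wp l = S.wp l * S.sRefl i := by
  have hd : S.d i = S.d p := by
    have := S.K_wp l (α i) (α i)
    rw [h, K_alpha_alpha, K_alpha_alpha] at this
    linarith
  apply LinearMap.ext
  intro v
  simp only [Module.End.mul_apply]
  rw [sRefl_apply, sRefl_apply, map_sub, map_smul, h]
  have := S.K_wp l (α i) v
  rw [h, K_alpha_left, K_alpha_left, hd] at this
  rw [mul_left_cancel₀ (S.d_pos p).ne' this]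

/-! integrality -/

def IsI (v : V n) : Prop := ∀ k, ∃ z : ℤ, v k = z

lemma isI_alpha (i : Fin n) : IsI (α i : V n) := by
  intro k
  rw [alpha_apply]
  by_cases h : k = i
  · exact ⟨1, by simp [h]⟩
  · exact ⟨0, by simp [h]⟩

lemma isI_sRefl (i : Fin n) {v : V n} (hv : IsI v) : IsI (S.sRefl i v) := by
  choose z hz using hv
  intro k
  by_cases h : k = i
  · refine ⟨z k - ∑ j, S.A i j * z j, ?_⟩
    rw [sRefl_apply, coefL_apply]
    simp [alpha_apply, h, hz]
  · exact ⟨z k, by rw [S.sRefl_apply_ne i k h, hz]⟩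

lemma isI_wp (l : List (Fin n)) {v : V n} (hv : IsI v) : IsI (S.wp l v) := by
  induction l with
  | nil => simpa [wp_nil] using hv
  | cons p l ih => rw [wp_cons]; exact S.isI_sRefl p ih

lemma alpha_ne_zero (i : Fin n) : (α i : V n) ≠ 0 := by
  intro h
  have := congrFun h i
  simp [alpha_apply] at this

lemma prim (l : List (Fin n)) (m p : Fin n) (r : ℝ) (hr : 0 ≤ r)
    (h : S.wp l (α m) = r • α p) : r = 1 := by
  obtain ⟨z, hz⟩ := S.isI_wp l (isI_alpha m) p
  rw [h] at hz
  simp [alpha_apply] at hz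
  have h2 : α m = r • S.wp l.reverse (α p) := by
    rw [← map_smul, ← h, wp_rev_apply]
  obtain ⟨y, hy⟩ := S.isI_wp l.reverse (isI_alpha p) m
  have h3 := congrFun h2 m
  simp only [Pi.smul_apply, hy, alpha_apply, if_true, smul_eq_mul, hz] at h3
  have h4 : z * y = 1 := by exact_mod_cast h3.symm
  rw [hz] at hr ⊢
  have hz0 : 0 ≤ z := by exact_mod_cast hr
  have := Int.eq_one_or_neg_one_of_mul_eq_one h4
  rcases this with h | h
  · simp [h]
  · omega

def Nn (v : V n) : Prop := ∀ k, 0 ≤ v k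

/-- a nonnegative root sent to a nonpositive one by `s_p` is `α_p`. -/
lemma eq_alpha (l : List (Fin n)) (m p : Fin n) (h1 : Nn (S.wp l (α m)))
    (h2 : Nn (-(S.sRefl p (S.wp l (α m))))) : S.wp l (α m) = α p := by
  have h : S.wp l (α m) = (S.wp l (α m) p) • α p := by
    funext k
    by_cases hk : k = p
    · simp [alpha_apply, hk]
    · have a := h1 k
      have b := h2 k
      rw [Pi.neg_apply, S.sRefl_apply_ne p k hk] at b
      simp [alpha_apply, hk]; linarith
  have := S.prim l m p _ (h1 p) h
  rw [this, one_smul] at h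
  exact h

lemma not_both {v : V n} (h1 : Nn v) (h2 : Nn (-v)) : v = 0 := by
  funext k
  have a := h1 k
  have b := h2 k
  simp at b
  simp; linarith

lemma alpha_Nn (i : Fin n) : Nn (α i : V n) := by
  intro k; rw [alpha_apply]; split_ifs <;> norm_num

lemma exchange (b : List (Fin n)) (i : Fin n)
    (hs : ∀ c, c <:+ b → Nn (S.wp c (α i)) ∨ Nn (-(S.wp c (α i))))
    (hn : Nn (-(S.wp b (α i)))) :
    ∃ b', b'.Sublist b ∧ b'.length < b.length ∧ S.wp b' = S.wp b * S.sRefl i := by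
  induction b with
  | nil =>
    exact absurd (not_both (alpha_Nn i) (by simpa [wp_nil] using hn)) (alpha_ne_zero i)
  | cons p c ih =>
    rcases hs c (List.suffix_cons p c) with h | h
    · rw [wp_cons, Module.End.mul_apply] at hn
      have := S.conj c i p (S.eq_alpha c i p h hn)
      refine ⟨c, List.sublist_cons_self p c, by simp, ?_⟩
      rw [wp_cons, mul_assoc, ← this, ← mul_assoc, sRefl_sq, one_mul]
    · obtain ⟨c', h1, h2, h3⟩ := ih (fun d hd => hs d (hd.trans (List.suffix_cons p c))) h
      exact ⟨p :: c', h1.cons_cons p, by simpa using h2, by rw [wp_cons, wp_cons, h3, mul_assoc]⟩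

lemma supp_wp (i j : Fin n) (b : List (Fin n)) (hb : ∀ p ∈ b, p = i ∨ p = j) (k : Fin n)
    (hi : k ≠ i) (hj : k ≠ j) : S.wp b (α i) k = 0 := by
  induction b with
  | nil => simp [wp_nil, alpha_apply, hi]
  | cons p c ih =>
    rw [wp_cons, Module.End.mul_apply, sRefl_apply_ne, ih]
    · intro q hq; exact hb q (List.mem_cons_of_mem p hq)
    · rcases hb p (by simp) with h | h <;> simpa [h]

lemma comb (i j : Fin n) (hij : i ≠ j) (v : V n) (h : ∀ k, k ≠ i → k ≠ j → v k = 0) :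
    v = v i • α i + v j • α j := by
  funext k
  by_cases h1 : k = i
  · subst h1; simp [alpha_apply, hij]
  · by_cases h2 : k = j
    · subst h2; simp [alpha_apply, h1]
    · simp [alpha_apply, h1, h2, h]

lemma rank2 (i j : Fin n) (hij : i ≠ j) (b : List (Fin n)) (hb : ∀ p ∈ b, p = i ∨ p = j) :
    Nn (S.wp b (α i)) ∨ Nn (-(S.wp b (α i))) := by
  have hK := S.K_wp b (α i) (α i)
  have hs := S.supp_wp i j b hb
  have hI := S.isI_wp b (isI_alpha i)
  set v := S.wp b (α i) with hv
  have hc := comb i j hij v hs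
  obtain ⟨x, hx⟩ := hI i
  obtain ⟨y, hy⟩ := hI j
  rw [K_alpha_alpha] at hK
  have e : S.K v v = 2 * S.d i * x ^ 2 + 2 * S.d i * S.A i j * x * y + 2 * S.d j * y ^ 2 := by
    have e1 : ∀ z, S.K v z = x * (S.d i * S.coefL i z) + y * (S.d j * S.coefL j z) := by
      intro z
      have : v = (0 - (-(x:ℝ)) • α i) - (-(y:ℝ)) • α j := by
        conv_lhs => rw [hc, hx, hy]
        module
      rw [this, K_sub_smul_left, K_sub_smul_left, K_alpha_left, K_alpha_left]
      simp [K]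
    have e2 : ∀ p, S.coefL p v = S.A p i * x + S.A p j * y := by
      intro p
      conv_lhs => rw [hc]
      rw [map_add, map_smul, map_smul, coefL_apply, coefL_apply, hx, hy]
      simp [alpha_apply]; ring
    rw [e1, e2, e2, S.diag, S.diag]
    have := S.dsymm i j
    push_cast
    linear_combination -(x * y : ℝ) * this
  rw [e] at hK
  have hA : (S.A i j : ℝ) ≤ 0 := by exact_mod_cast S.offdiag_nonpos i j hij
  have di := S.d_pos i
  have dj := S.d_pos j
  have key : 0 ≤ x * y := by
    by_contra hneg
    push Not at hneg
    have hx0 : x ≠ 0 := by rintro rfl; simp at hneg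
    have hy0 : y ≠ 0 := by rintro rfl; simp at hneg
    have h1 : (1:ℝ) ≤ (x:ℝ) ^ 2 := by
      have : 0 < x ^ 2 := by positivity
      exact_mod_cast this
    have h2 : (0:ℝ) < (y:ℝ) ^ 2 := by
      have : (y:ℝ) ≠ 0 := by exact_mod_cast hy0
      positivity
    have h3 : (x * y : ℝ) < 0 := by exact_mod_cast hneg
    have h4 : 0 ≤ S.d i * (S.A i j * (x * y : ℝ)) :=
      mul_nonneg di.le (mul_nonneg_of_nonpos_of_nonpos hA h3.le)
    have h5 : 0 < S.d j * (y:ℝ) ^ 2 := by positivity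
    have h6 : S.d i * 1 ≤ S.d i * (x:ℝ) ^ 2 := mul_le_mul_of_nonneg_left h1 di.le
    nlinarith
  rcases mul_nonneg_iff.1 key with ⟨h1, h2⟩ | ⟨h1, h2⟩
  · left
    intro k
    by_cases hi : k = i
    · rw [hi, hx]; exact_mod_cast h1
    · by_cases hj : k = j
      · rw [hj, hy]; exact_mod_cast h2
      · rw [hs k hi hj]
  · right
    intro k
    rw [Pi.neg_apply, neg_nonneg]
    by_cases hi : k = i
    · rw [hi, hx]; exact_mod_cast h1
    · by_cases hj : k = j
      · rw [hj, hy]; exact_mod_cast h2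
      · rw [hs k hi hj]

def Red (a : List (Fin n)) : Prop := ∀ a', S.wp a' = S.wp a → a.length ≤ a'.length

lemma exists_red (a : List (Fin n)) : ∃ a', S.wp a' = S.wp a ∧ S.Red a' := by
  classical
  have hex : ∃ k, ∃ a', S.wp a' = S.wp a ∧ a'.length = k := ⟨_, a, rfl, rfl⟩
  obtain ⟨a', h1, h2⟩ := Nat.find_spec hex
  refine ⟨a', h1, fun a'' h => ?_⟩
  rw [h2]
  exact Nat.find_min' hex ⟨a'', h.trans h1, rfl⟩

lemma main_pos : ∀ (N : ℕ) (a : List (Fin n)), a.length = N → S.Red a → ∀ i,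
    (∀ a', S.wp a' = S.wp a * S.sRefl i → a.length ≤ a'.length) → Nn (S.wp a (α i)) := by
  intro N
  induction N using Nat.strong_induction_on with
  | _ N ih =>
  intro a haN hr i hi
  rcases List.eq_nil_or_concat a with rfl | ⟨a0, j, rfl⟩
  · simpa [wp_nil] using alpha_Nn i
  rw [List.concat_eq_append] at *
  have hij : i ≠ j := by
    rintro rfl
    have := hi a0 (by rw [wp_append, wp_single, mul_assoc, sRefl_sq, mul_one])
    simp at this
  set w := S.wp (a0 ++ [j]) with hw
  classical
  let Q : ℕ → Prop := fun k => ∃ u b : List (Fin n), (∀ p ∈ b, p = i ∨ p = j) ∧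
    S.wp u * S.wp b = w ∧ u.length + b.length = N ∧ u.length = k
  have hex : ∃ k, Q k := ⟨a0.length, a0, [j], by simp, by rw [hw, wp_append],
    by simpa using haN, rfl⟩
  have hmin : ∀ k, Q k → Nat.find hex ≤ k := fun k hk => Nat.find_min' hex hk
  obtain ⟨u, b, hb, hub, hlen, hu⟩ := Nat.find_spec hex
  rw [← hu] at hmin
  have hlt : u.length < N := by
    have := hmin a0.length ⟨a0, [j], by simp, by rw [hw, wp_append], by simpa using haN, rfl⟩
    simp at haN
    omega
  have hured : S.Red u := by
    intro u' hu'
    have := hr (u' ++ b) (by rw [wp_append, hu', hub])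
    rw [haN] at this
    simp at this
    omega
  have hupos : ∀ m, m = i ∨ m = j → Nn (S.wp u (α m)) := by
    intro m hm
    refine ih _ hlt u rfl hured m ?_
    intro u' hu'
    by_contra hcon
    push Not at hcon
    have e : S.wp u' * S.wp (m :: b) = w := by
      rw [hu', wp_cons, mul_assoc, ← mul_assoc (S.sRefl m), sRefl_sq, one_mul, hub]
    have h1 := hr (u' ++ (m :: b)) (by rw [wp_append, e])
    rw [haN] at h1
    simp at h1
    have := hmin u'.length ⟨u', m :: b, by
      intro p hp
      rcases List.mem_cons.1 hp with h | h
      · rw [h]; exact hm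
      · exact hb p h, e, by simp; omega, rfl⟩
    omega
  have hbpos : Nn (S.wp b (α i)) := by
    rcases S.rank2 i j hij b hb with h | h
    · exact h
    · exfalso
      obtain ⟨b', _, h2, h3⟩ := S.exchange b i (fun c hc => S.rank2 i j hij c
        (fun p hp => hb p (hc.subset hp))) h
      have := hi (u ++ b') (by rw [wp_append, h3, ← mul_assoc, hub])
      rw [haN] at this
      simp at this
      omega
  rw [← hub, Module.End.mul_apply, comb i j hij _ (S.supp_wp i j b hb), map_add, map_smul, map_smul]
  intro k
  have h1 := hupos i (Or.inl rfl) k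
  have h2 := hupos j (Or.inr rfl) k
  have h3 := hbpos i
  have h4 := hbpos j
  simp only [Pi.add_apply, Pi.smul_apply, smul_eq_mul]
  positivity

lemma pos_or_neg (a : List (Fin n)) (i : Fin n) :
    Nn (S.wp a (α i)) ∨ Nn (-(S.wp a (α i))) := by
  obtain ⟨b, hb, hr⟩ := S.exists_red a
  rw [← hb]
  by_cases h : ∀ a', S.wp a' = S.wp b * S.sRefl i → b.length ≤ a'.length
  · exact Or.inl (S.main_pos _ b rfl hr i h)
  · right
    push Not at h
    obtain ⟨c, hc, hcl⟩ := h
    obtain ⟨c', hc', hr'⟩ := S.exists_red c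
    have hle := hr' c hc'.symm
    have e : S.wp c' * S.sRefl i = S.wp b := by
      rw [hc', hc, mul_assoc, sRefl_sq, mul_one]
    have := S.main_pos _ c' rfl hr' i (fun a' ha' => by
      have := hr a' (ha'.trans e)
      omega)
    rw [← e, Module.End.mul_apply, sRefl_alpha, map_neg, neg_neg]
    exact this

lemma eq_one_of_pos (a : List (Fin n)) (h : ∀ i, Nn (S.wp a (α i))) : S.wp a = 1 := by
  obtain ⟨b, hb, hr⟩ := S.exists_red a
  rw [← hb] at h ⊢
  rcases List.eq_nil_or_concat b with rfl | ⟨c, i, rfl⟩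
  · rfl
  · exfalso
    rw [List.concat_eq_append] at *
    have h1 := h i
    rw [wp_append, wp_single, Module.End.mul_apply, sRefl_alpha, map_neg] at h1
    obtain ⟨c', _, h2, h3⟩ := S.exchange c i (fun d _ => S.pos_or_neg d i) h1
    have := hr c' (by rw [h3, wp_append, wp_single])
    simp at this
    omega

/-! roots -/

lemma real_iff (β : V n) : β ∈ S.realRoots ↔ ∃ l m, β = S.wp l (α m) := by
  constructor
  · rintro ⟨w, hw, m, rfl⟩
    obtain ⟨l, rfl⟩ := S.exists_wp hw
    exact ⟨l, m, rfl⟩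
  · rintro ⟨l, m, rfl⟩
    exact ⟨_, S.wp_mem l, m, rfl⟩

lemma real_wp (l : List (Fin n)) {β : V n} (h : β ∈ S.realRoots) : S.wp l β ∈ S.realRoots := by
  obtain ⟨a, m, rfl⟩ := (S.real_iff β).1 h
  exact (S.real_iff _).2 ⟨l ++ a, m, by rw [wp_append, Module.End.mul_apply]⟩

lemma real_neg {β : V n} (h : β ∈ S.realRoots) : -β ∈ S.realRoots := by
  obtain ⟨a, m, rfl⟩ := (S.real_iff β).1 h
  exact (S.real_iff _).2 ⟨a ++ [m], m, by
    rw [wp_append, wp_single, Module.End.mul_apply, sRefl_alpha, map_neg]⟩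

lemma real_sign {β : V n} (h : β ∈ S.realRoots) : Nn β ∨ Nn (-β) := by
  obtain ⟨a, m, rfl⟩ := (S.real_iff β).1 h
  exact S.pos_or_neg a m

lemma real_ne {β : V n} (h : β ∈ S.realRoots) : β ≠ 0 := by
  obtain ⟨a, m, rfl⟩ := (S.real_iff β).1 h
  intro h0
  exact alpha_ne_zero m (S.wp_inj a (by rw [h0, map_zero]))

lemma real_alpha (i : Fin n) : α i ∈ S.realRoots := (S.real_iff _).2 ⟨[], i, by simp [wp_nil]⟩

lemma pos_alpha (i : Fin n) : α i ∈ S.posRoots := ⟨S.real_alpha i, alpha_Nn i⟩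

lemma real_sRefl (i : Fin n) {β : V n} (h : β ∈ S.realRoots) : S.sRefl i β ∈ S.realRoots := by
  rw [← wp_single]; exact S.real_wp _ h

lemma eq_alpha' {β : V n} (hβ : β ∈ S.posRoots) (p : Fin n) (h : Nn (-(S.sRefl p β))) :
    β = α p := by
  obtain ⟨⟨hr, hp⟩⟩ := And.intro hβ trivial
  obtain ⟨a, m, rfl⟩ := (S.real_iff β).1 hr
  exact S.eq_alpha a m p hp h

lemma sRefl_pos {β : V n} (hβ : β ∈ S.posRoots) (p : Fin n) (h : β ≠ α p) :
    S.sRefl p β ∈ S.posRoots := by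
  refine ⟨S.real_sRefl p hβ.1, ?_⟩
  rcases S.real_sign (S.real_sRefl p hβ.1) with h1 | h1
  · exact h1
  · exact absurd (S.eq_alpha' hβ p h1) h

lemma exists_ne {β : V n} (hβ : β ∈ S.posRoots) (p : Fin n) (h : β ≠ α p) :
    ∃ k, k ≠ p ∧ 0 < β k := by
  by_contra hcon
  push Not at hcon
  apply h
  apply S.eq_alpha' hβ
  have e : β = β p • α p := by
    funext k
    by_cases hk : k = p
    · simp [alpha_apply, hk]
    · simp [alpha_apply, hk, le_antisymm (hcon k hk) (hβ.2 k)]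
  rw [e, map_smul, sRefl_alpha]
  intro k
  have := hβ.2 p
  have := alpha_Nn p k
  simp only [smul_neg, neg_neg, Pi.smul_apply, smul_eq_mul]
  positivity

lemma inv_finite (l : List (Fin n)) : (S.inversions (S.wp l)).Finite := by
  induction l with
  | nil =>
    convert Set.finite_empty
    ext β
    simp only [Set.mem_empty_iff_false, iff_false]
    rintro ⟨h1, h2⟩
    exact S.real_ne h1.1 (not_both h1.2 h2.2)
  | cons p c ih =>
    refine (ih.union (Set.finite_singleton (S.wp c.reverse (α p)))).subset ?_
    rintro β ⟨h1, h2⟩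
    have hr := S.real_wp c h1.1
    rcases S.real_sign hr with h | h
    · right
      rw [wp_cons, Module.End.mul_apply] at h2
      rw [Set.mem_singleton_iff, ← S.eq_alpha' ⟨hr, h⟩ p h2.2, wp_rev_apply]
    · left
      exact ⟨h1, S.real_neg hr, h⟩

lemma inv_sRefl (i : Fin n) : S.inversions (S.sRefl i) = {α i} := by
  ext β
  constructor
  · rintro ⟨h1, h2⟩
    exact S.eq_alpha' h1 i h2.2
  · rintro rfl
    exact ⟨S.pos_alpha i, by rw [sRefl_alpha, neg_neg]; exact S.pos_alpha i⟩

lemma inv_simple {j : Module.End ℝ (V n)} (hj : j ∈ S.W) (k : Fin n)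
    (h : S.inversions j = {α k}) : j = S.sRefl k := by
  obtain ⟨l, rfl⟩ := S.exists_wp hj
  have h1 : S.wp (l ++ [k]) = 1 := by
    apply S.eq_one_of_pos
    intro m
    rw [wp_append, wp_single, Module.End.mul_apply]
    by_cases hm : m = k
    · subst hm
      have : α m ∈ S.inversions (S.wp l) := by rw [h]; rfl
      rw [sRefl_alpha, map_neg]
      exact this.2.2
    · have hne : (α m : V n) ≠ α k := by
        intro e
        have := congrFun e m
        simp [alpha_apply, hm] at this
      have hp := S.sRefl_pos (S.pos_alpha m) k hne
      have hr := S.real_wp l hp.1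
      rcases S.real_sign hr with h2 | h2
      · exact h2
      · exfalso
        have : S.sRefl k (α m) ∈ S.inversions (S.wp l) := ⟨hp, S.real_neg hr, h2⟩
        rw [h, Set.mem_singleton_iff] at this
        have h3 := S.sRefl_sRefl k (α m)
        rw [this, sRefl_alpha] at h3
        have := congrFun h3 m
        simp [alpha_apply, hm] at this
  rw [wp_append, wp_single] at h1
  have : S.wp l * (S.sRefl k * S.sRefl k) = S.sRefl k := by rw [← mul_assoc, h1, one_mul]
  rwa [sRefl_sq, mul_one] at this

lemma canonical (i : Fin n) {γ : V n} (hγ : γ ∈ S.posRoots) (hne : γ ≠ α i) :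
    S.IsCanonicalRoot (S.sub2 (α i) γ) (α i) := by
  obtain ⟨k, hki, hk⟩ := S.exists_ne hγ i hne
  have hspan : ∀ v ∈ S.sub2 (α i) γ, ∃ a b : ℝ, a • α i + b • γ = v := by
    intro v hv
    exact Submodule.mem_span_pair.1 hv.2
  have hal : α i ∈ S.sub2 (α i) γ := ⟨S.real_alpha i, Submodule.subset_span (by simp)⟩
  -- the element w
  obtain ⟨l, γ', hγ', hγ'p, hwα, hwγ⟩ : ∃ (l : List (Fin n)) (γ' : V n),
      γ' ∈ S.sub2 (α i) γ ∧ γ' ∈ S.posRoots ∧ Nn (S.wp l (α i)) ∧ Nn (-(S.wp l γ')) := by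
    obtain ⟨u, m, hu⟩ := (S.real_iff γ).1 hγ.1
    have hneg : S.wp (m :: u.reverse) γ = -α m := by
      rw [hu, wp_cons, Module.End.mul_apply, wp_rev_apply, sRefl_alpha]
    rcases S.pos_or_neg (m :: u.reverse) i with h | h
    · refine ⟨m :: u.reverse, γ, ⟨hγ.1, Submodule.subset_span (by simp)⟩, hγ, h, ?_⟩
      rw [hneg, neg_neg]; exact alpha_Nn m
    · refine ⟨(m :: u.reverse) ++ [i], S.sRefl i γ, ⟨S.real_sRefl i hγ.1, ?_⟩,
        S.sRefl_pos hγ i hne, ?_, ?_⟩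
      · rw [sRefl_apply]
        exact Submodule.sub_mem _ (Submodule.subset_span (by simp))
          (Submodule.smul_mem _ _ (Submodule.subset_span (by simp)))
      · rw [wp_append, wp_single, Module.End.mul_apply, sRefl_alpha, map_neg]; exact h
      · rw [wp_append, wp_single, Module.End.mul_apply, sRefl_sRefl, hneg, neg_neg]
        exact alpha_Nn m
  have hTfin : (S.sub2 (α i) γ ∩ S.inversions (S.wp l)).Finite :=
    (S.inv_finite l).subset Set.inter_subset_right
  obtain ⟨q, ⟨hq1, hq2⟩, hqmin⟩ := Set.exists_min_image _ (fun v : V n => v i / v k) hTfin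
    ⟨γ', hγ', hγ'p, S.real_neg (S.real_wp l hγ'p.1), hwγ⟩
  have hqk : 0 < q k := by
    rcases (hq2.1.2 k).lt_or_eq with h | h
    · exact h
    · exfalso
      obtain ⟨a, b, hab⟩ := hspan q hq1
      have hb : b = 0 := by
        have := congrFun hab k
        simp [alpha_apply, hki, ← h] at this
        rcases this with h | h
        · exact h
        · exact absurd h hk.ne'
      rw [hb, zero_smul, add_zero] at hab
      have ha : a = q i := by rw [← hab]; simp [alpha_apply]
      have h0 := hq2.1.2 i
      have : Nn (S.wp l q) := by
        intro t
        rw [← hab, map_smul, ha]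
        exact mul_nonneg h0 (hwα t)
      exact S.real_ne (S.real_wp l hq2.1.1) (not_both this hq2.2.2)
  refine ⟨q, hal, hq1, ?_⟩
  rintro v ⟨hv1, hv2⟩
  have hy : 0 ≤ v k / q k := div_nonneg (hv2.2 k) hqk.le
  have hdec : v = (v i - v k / q k * q i) • α i + (v k / q k) • q := by
    obtain ⟨a, b, hab⟩ := hspan v hv1
    obtain ⟨a', b', hab'⟩ := hspan q hq1
    have e1 : v k = b * γ k := by rw [← hab]; simp [alpha_apply, hki]
    have e2 : q k = b' * γ k := by rw [← hab']; simp [alpha_apply, hki]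
    have e3 : v i = a + b * γ i := by rw [← hab]; simp [alpha_apply]
    have e4 : q i = a' + b' * γ i := by rw [← hab']; simp [alpha_apply]
    have hb' : b' ≠ 0 := by rintro rfl; simp [e2] at hqk
    have e5 : v k / q k = b / b' := by rw [e1, e2]; field_simp
    rw [e5, e3, e4]
    conv_lhs => rw [← hab]
    rw [← hab']
    funext t
    simp only [Pi.add_apply, Pi.smul_apply, smul_eq_mul]
    field_simp
    ring
  refine ⟨_, _, ?_, hy, hdec⟩
  by_contra hx
  push Not at hx
  set y := v k / q k with hydef
  set x := v i - y * q i with hxdef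
  have hvk : 0 < v k := by
    rcases (hv2.2 k).lt_or_eq with h | h
    · exact h
    · exfalso
      have : y = 0 := by rw [hydef, ← h, zero_div]
      rw [this, zero_mul, sub_zero] at hxdef
      have := hv2.2 i
      linarith
  have hvT : v ∈ S.sub2 (α i) γ ∩ S.inversions (S.wp l) := by
    refine ⟨hv1, hv2, S.real_neg (S.real_wp l hv2.1), ?_⟩
    intro t
    rw [hdec, map_add, map_smul, map_smul]
    have h1 := hwα t
    have h2 := hq2.2.2 t
    simp only [Pi.neg_apply, Pi.add_apply, Pi.smul_apply, smul_eq_mul] at *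
    nlinarith
  have := hqmin v hvT
  rw [div_le_div_iff₀ hqk hvk] at this
  have e : y * q k = v k := by rw [hydef]; field_simp
  rw [← e] at this
  nlinarith

lemma cutSet_alpha (i : Fin n) : S.cutSet (α i) = ∅ := by
  ext γ
  simp only [Set.mem_empty_iff_false, iff_false]
  rintro ⟨h1, _, h3, _, h5⟩
  exact h5 (S.canonical i h1 h3)

lemma exists_cut {β : V n} (hβ : β ∈ S.posRoots) (hne : ∀ i, β ≠ α i) :
    ∃ i, α i ∈ S.cutSet β := by
  obtain ⟨i, hi⟩ : ∃ i, 0 < S.coefL i β := by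
    by_contra hcon
    push Not at hcon
    obtain ⟨a, m, hm⟩ := (S.real_iff β).1 hβ.1
    have h1 : S.K β β = 2 * S.d m := by rw [hm, K_wp, K_alpha_alpha]
    have h2 : S.K β β = ∑ p, β p * (S.d p * S.coefL p β) := by
      unfold K
      refine Finset.sum_congr rfl fun p _ => ?_
      rw [coefL_apply, Finset.mul_sum, Finset.mul_sum]
      refine Finset.sum_congr rfl fun q _ => ?_
      ring
    have h3 : ∑ p, β p * (S.d p * S.coefL p β) ≤ 0 :=
      Finset.sum_nonpos fun p _ => mul_nonpos_of_nonneg_of_nonpos (hβ.2 p)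
        (mul_nonpos_of_nonneg_of_nonpos (S.d_pos p).le (hcon p))
    have := S.d_pos m
    linarith
  refine ⟨i, S.pos_alpha i, hβ, (hne i).symm, ?_, ?_⟩
  · have := S.canonical i hβ (hne i)
    unfold sub2 at *
    rwa [Set.pair_comm]
  · rintro ⟨q, _, hq, hall⟩
    have hmem : ∀ v ∈ S.posRoots, v ∈ Submodule.span ℝ ({β, α i} : Set (V n)) →
        ∃ a b : ℝ, 0 ≤ a ∧ 0 ≤ b ∧ v = a • β + b • q :=
      fun v h1 h2 => hall v ⟨⟨h1.1, h2⟩, h1⟩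
    obtain ⟨a, b, ha, hb, e1⟩ := hmem (α i) (S.pos_alpha i) (Submodule.subset_span (by simp))
    obtain ⟨a', b', ha', hb', e2⟩ := hmem (S.sRefl i β) (S.sRefl_pos hβ i (hne i)) (by
      rw [sRefl_apply]
      exact Submodule.sub_mem _ (Submodule.subset_span (by simp))
          (Submodule.smul_mem _ _ (Submodule.subset_span (by simp))))
    set c := S.coefL i β
    have e3 : β = (a' + c * a) • β + (b' + c * b) • q := by
      have : β = S.sRefl i β + c • α i := by rw [sRefl_apply]; simp [c]
      conv_lhs => rw [this, e2, e1]
      module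
    obtain ⟨k, hk, hβk⟩ := S.exists_ne hβ i (hne i)
    -- α i is a multiple of β gives contradiction
    have hpar : ∀ r : ℝ, α i ≠ r • β := by
      intro r hr
      have h1 := congrFun hr k
      simp [alpha_apply, hk] at h1
      rcases h1 with h | h
      · rw [h, zero_smul] at hr; exact alpha_ne_zero i hr
      · exact hβk.ne' h
    have hbb : b ≠ 0 := by
      intro h
      rw [h, zero_smul, add_zero] at e1
      exact hpar a e1
    have hbpos : 0 < b := lt_of_le_of_ne hb (Ne.symm hbb)
    have hD : 0 < b' + c * b := by positivity
    have e4 : q = ((1 - (a' + c * a)) / (b' + c * b)) • β := by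
      have h5 : (b' + c * b) • q = (1 - (a' + c * a)) • β := by
        rw [sub_smul, one_smul]
        exact (sub_eq_of_eq_add' e3).symm
      rw [div_eq_inv_mul, mul_smul, ← h5, smul_smul, inv_mul_cancel₀ hD.ne', one_smul]
    rw [e4, smul_smul, ← add_smul] at e1
    exact hpar _ e1

lemma pairing_alpha (x : V n) (i : Fin n) : pairing x (α i) = x i := by
  simp [pairing, alpha_apply]

lemma continuous_pairing (β : V n) : Continuous (fun x : V n => pairing x β) := by
  unfold pairing; fun_prop

lemma shard_simple (i : Fin n) {Z : Set (V n)} (hZ : S.IsShardIn (α i) Z) :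
    Z = {x | pairing x (α i) = 0} := by
  obtain ⟨x, hx, rfl⟩ := hZ
  have hg : S.shardGround (α i) = {x | pairing x (α i) = 0} := by
    ext y; simp [shardGround, cutSet_alpha]
  rw [hg] at hx ⊢
  have hconv : Convex ℝ {x : V n | pairing x (α i) = 0} := by
    intro u hu v hv a b _ _ _
    simp only [pairing_alpha, Set.mem_ofPred_eq] at *
    simp [hu, hv]
  rw [hconv.isPreconnected.connectedComponentIn hx]
  exact (isClosed_eq (continuous_pairing _) continuous_const).closure_eq

lemma shard_full {β : V n} (hβ : β ∈ S.posRoots)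
    (hZ : S.IsShardIn β {x | pairing x β = 0}) : ∃ i, β = α i := by
  by_contra hcon
  push Not at hcon
  obtain ⟨i, hi⟩ := S.exists_cut hβ hcon
  obtain ⟨x, hx, hZ⟩ := hZ
  have hxi : x i ≠ 0 := by rw [← pairing_alpha x i]; exact hx.2 _ hi
  set C := connectedComponentIn (S.shardGround β) x with hC
  have hpre : IsPreconnected C := isPreconnected_connectedComponentIn
  have hxC : x ∈ C := mem_connectedComponentIn hx
  have hne : ∀ y ∈ C, y i ≠ 0 := by
    intro y hy
    rw [← pairing_alpha y i]
    exact (connectedComponentIn_subset _ _ hy).2 _ hi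
  have hsub : C ⊆ {y : V n | 0 ≤ x i * y i} := by
    intro y hy
    by_contra hlt
    simp only [Set.mem_ofPred_eq, not_le] at hlt
    have hcont : ContinuousOn (fun z : V n => x i * z i) C := by fun_prop
    obtain ⟨z, hz, hz0⟩ := hpre.intermediate_value hy hxC hcont
      (show (0:ℝ) ∈ Set.Icc (x i * y i) (x i * x i) from ⟨hlt.le, mul_self_nonneg _⟩)
    rcases mul_eq_zero.1 hz0 with h | h
    · exact hxi h
    · exact hne z hz h
  have hcl : IsClosed {y : V n | 0 ≤ x i * y i} :=
    isClosed_le continuous_const (by fun_prop)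
  have hm : -x ∈ {x : V n | pairing x β = 0} := by
    have := hx.1
    simp only [pairing, Set.mem_ofPred_eq, Pi.neg_apply, neg_mul, Finset.sum_neg_distrib] at *
    rw [this, neg_zero]
  rw [hZ] at hm
  have := closure_minimal hsub hcl hm
  simp only [Set.mem_ofPred_eq, Pi.neg_apply] at this
  have : 0 < x i * x i := mul_self_pos.2 hxi
  linarith

end Setup


/-- `Sh(j) = β_t^⊥` if and only if `j` is a simple reflection. -/
theorem statement1 {n : ℕ} (S : Setup n) (j jstar : Module.End ℝ (V n)) (β : V n)
    (hji : S.JoinIrr j) (hcov : S.CoverData j jstar β) :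
    ∀ Z : Set (V n), S.IsShardIn β Z → chamber j ∩ chamber jstar ⊆ Z →
      (Z = {x | pairing x β = 0} ↔ ∃ i, j = S.sRefl i) := by
  intro Z hZ _
  obtain ⟨hc1, hβ, hinv⟩ := hcov
  constructor
  · intro e
    rw [e] at hZ
    obtain ⟨k, rfl⟩ := S.shard_full hβ hZ
    refine ⟨k, ?_⟩
    have hkj : α k ∈ S.inversions j := by rw [hinv]; exact Or.inr rfl
    have hks : α k ∉ S.inversions jstar := by
      intro h
      have : S.inversions j = S.inversions jstar := by
        rw [hinv]; exact Set.union_eq_left.2 (Set.singleton_subset_iff.2 h)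
      have h3 := hc1.2.2.1
      unfold Setup.wlt at h3
      rw [this] at h3
      exact (ssubset_irrefl _) h3
    by_cases heq : S.inversions j = {α k}
    · exact S.inv_simple hji.1 k heq
    exfalso
    have hfin : (S.inversions j).Finite := by
      obtain ⟨l, rfl⟩ := S.exists_wp hji.1
      exact S.inv_finite l
    let T : Set (Set (V n)) := {X | ∃ u ∈ S.W, S.inversions u = X ∧ α k ∈ X ∧
      X ⊂ S.inversions j}
    have hTfin : T.Finite := by
      refine hfin.finite_subsets.subset ?_
      rintro X ⟨u, _, _, _, hX⟩
      exact hX.subset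
    have hTne : T.Nonempty := ⟨_, S.sRefl k, S.sRefl_mem k, rfl, by rw [S.inv_sRefl]; rfl, by
      rw [S.inv_sRefl]
      exact (Set.singleton_subset_iff.2 hkj).ssubset_of_ne (fun h => heq h.symm)⟩
    obtain ⟨X, hX⟩ := hTfin.exists_maximal hTne
    obtain ⟨⟨u, huW, rfl, hku, huj⟩, hmax⟩ := hX
    have hcu : S.WCovBy u j := by
      refine ⟨huW, hji.1, huj, ?_⟩
      rintro v hv ⟨h1, h2⟩
      have := hmax (show S.inversions v ∈ T from ⟨v, hv, rfl, h1.subset hku, h2⟩) h1.subset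
      exact h1.not_subset this
    have : u = jstar := hji.2.unique hcu hc1
    rw [this] at hku
    exact hks hku
  · rintro ⟨i, rfl⟩
    have : β ∈ S.inversions (S.sRefl i) := by rw [hinv]; exact Or.inr rfl
    rw [S.inv_sRefl, Set.mem_singleton_iff] at this
    subst this
    exact S.shard_simple i hZ

end PaperScat

end
end

section
/- Suppose A is of affine type and c is a Coxeter element of W. Then the functional −ω_c(·, δ) lies in the relative interior of the imaginary wall d_∞, and the functional ω_c(·, δ) does not lie in d_∞. (In the language of scattering diagrams: the imaginary wall (d_∞, f_∞) is gregarious and outgoing.) -/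
open scoped BigOperators Pointwise

noncomputable section

namespace PaperScat

section Helpers

variable {n : ℕ} (S : Setup n)

theorem K_add_left (x y z : V n) : S.K (x + y) z = S.K x z + S.K y z := by
  simp [Setup.K, add_mul, Finset.sum_add_distrib]

theorem K_smul_left (a : ℝ) (x z : V n) : S.K (a • x) z = a * S.K x z := by
  simp only [Setup.K, Finset.mul_sum, Pi.smul_apply, smul_eq_mul]
  refine Finset.sum_congr rfl fun p _ => Finset.sum_congr rfl fun q _ => by ring

theorem K_symm (x y : V n) : S.K x y = S.K y x := by
  unfold Setup.K
  rw [Finset.sum_comm]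
  refine Finset.sum_congr rfl fun p _ => Finset.sum_congr rfl fun q _ => ?_
  rw [S.dsymm q p]; ring

theorem K_add_right (x y z : V n) : S.K z (x + y) = S.K z x + S.K z y := by
  rw [K_symm, K_add_left, K_symm S x, K_symm S y]

theorem K_smul_right (a : ℝ) (x z : V n) : S.K z (a • x) = a * S.K z x := by
  rw [K_symm, K_smul_left, K_symm S x]

theorem coefL_apply (i : Fin n) (v : V n) : S.coefL i v = ∑ j, (S.A i j : ℝ) * v j := by
  simp [Setup.coefL]

theorem K_alpha (i : Fin n) (v : V n) : S.K (α i) v = S.d i * S.coefL i v := by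
  rw [coefL_apply, Setup.K, Finset.sum_eq_single i]
  · simp [α, Finset.mul_sum, mul_assoc]
  · intro p _ hp
    simp [α, Pi.single_apply, hp]
  · simp

theorem coefL_alpha (i : Fin n) : S.coefL i (α i) = 2 := by
  rw [coefL_apply, Finset.sum_eq_single i]
  · simp [α, S.diag]
  · intro p _ hp
    simp [α, Pi.single_apply, hp]
  · simp

theorem sRefl_apply (i : Fin n) (v : V n) : S.sRefl i v = v + (-(S.coefL i v)) • α i := by
  simp [Setup.sRefl, sub_eq_add_neg]

theorem K_sRefl (i : Fin n) (v : V n) : S.K (S.sRefl i v) (S.sRefl i v) = S.K v v := by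
  rw [sRefl_apply]
  simp only [K_add_left, K_add_right, K_smul_left, K_smul_right, K_alpha, K_symm S v (α i),
    coefL_alpha]
  ring

theorem K_W (w : Module.End ℝ (V n)) (hw : w ∈ S.W) : ∀ v, S.K (w v) (w v) = S.K v v := by
  unfold Setup.W at hw
  induction hw using Submonoid.closure_induction with
  | mem x hx => obtain ⟨i, rfl⟩ := hx; exact K_sRefl S i
  | one => intro v; rfl
  | mul x y _ _ hx hy => intro v; rw [Module.End.mul_apply, hx, hy]

theorem int_W (w : Module.End ℝ (V n)) (hw : w ∈ S.W) :
    ∀ v : Fin n → ℤ, ∃ u : Fin n → ℤ, w (fun i => (v i : ℝ)) = fun i => (u i : ℝ) := by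
  unfold Setup.W at hw
  induction hw using Submonoid.closure_induction with
  | mem x hx =>
    obtain ⟨i, rfl⟩ := hx
    intro v
    refine ⟨v + (-(∑ j, S.A i j * v j)) • Pi.single i 1, ?_⟩
    rw [sRefl_apply, coefL_apply]
    ext k
    by_cases hk : k = i <;> simp [α, Pi.single_apply, hk]
  | one => intro v; exact ⟨v, rfl⟩
  | mul x y _ _ hx hy =>
    intro v
    obtain ⟨u, hu⟩ := hy v
    obtain ⟨u', hu'⟩ := hx u
    exact ⟨u', by rw [Module.End.mul_apply, hu, hu']⟩

theorem K_null (h : S.PosSemidef) (v : V n) (hv : S.K v v = 0) (u : V n) : S.K v u = 0 := by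
  have hq := h u
  have h1 := h ((-(S.K u u + 1)) • v + (S.K v u) • u)
  simp only [K_add_left, K_add_right, K_smul_left, K_smul_right, K_symm S u v, hv] at h1
  by_contra hne
  have : 0 < S.K v u ^ 2 := by positivity
  nlinarith

theorem K_cont : Continuous fun v : V n => S.K v v := by
  unfold Setup.K
  fun_prop

theorem K_bound (h : S.PosSemidef) (δ : V n) (hδ : S.IsDelta δ) (aff : Fin n) :
    ∃ m : ℝ, 0 < m ∧ ∀ v : V n, v aff = 0 → m * ‖v‖ ^ 2 ≤ S.K v v := by
  have hpos : ∀ v : V n, v aff = 0 → v ≠ 0 → 0 < S.K v v := by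
    intro v hva hv0
    refine lt_of_le_of_ne (h v) fun h0 => hv0 ?_
    obtain ⟨r, hr⟩ := hδ.2.2 v (K_null S h v h0.symm)
    obtain ⟨m, hm, hmp, -⟩ := hδ.2.1
    have h1 : r * δ aff = 0 := by rw [hr] at hva; simpa using hva
    have h2 : δ aff ≠ 0 := by rw [hm]; exact_mod_cast (hmp aff).ne'
    have : r = 0 := by simpa [h2] using h1
    rw [hr, this, zero_smul]
  let C : Set (V n) := Metric.sphere 0 1 ∩ {v | v aff = 0}
  have hC : IsCompact C := (isCompact_sphere 0 1).inter_right
    (isClosed_eq (continuous_apply aff) continuous_const)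
  have hm : ∃ m : ℝ, 0 < m ∧ ∀ v ∈ C, m ≤ S.K v v := by
    rcases C.eq_empty_or_nonempty with he | hne
    · exact ⟨1, one_pos, by simp [he]⟩
    · obtain ⟨x, hx, hmin⟩ := hC.exists_isMinOn hne (K_cont S).continuousOn
      refine ⟨S.K x x, hpos x hx.2 ?_, fun v hv => hmin hv⟩
      rintro rfl
      simpa using hx.1
  obtain ⟨m, hm0, hm⟩ := hm
  refine ⟨m, hm0, fun v hv => ?_⟩
  by_cases hv0 : v = 0
  · subst hv0; simpa using h 0
  have hn : 0 < ‖v‖ := norm_pos_iff.mpr hv0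
  have := hm (‖v‖⁻¹ • v) ⟨by simp [norm_smul, hn.ne'], by simp [hv]⟩
  rw [K_smul_left, K_smul_right] at this
  calc m * ‖v‖ ^ 2 ≤ (‖v‖⁻¹ * (‖v‖⁻¹ * S.K v v)) * ‖v‖ ^ 2 := by gcongr
    _ = S.K v v := by field_simp

theorem fin_roots (h : S.PosSemidef) (δ : V n) (hδ : S.IsDelta δ) (aff : Fin n) :
    {β | β ∈ S.realRoots ∧ β aff = 0}.Finite := by
  obtain ⟨m, hm0, hm⟩ := K_bound S h δ hδ aff
  set C : ℝ := ∑ i, S.K (α i) (α i) with hC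
  obtain ⟨N, hN⟩ := exists_nat_ge (C / m + 1)
  refine ((Set.finite_Icc (fun _ => -(N : ℤ)) (fun _ : Fin n => (N : ℤ))).image
    (fun u : Fin n → ℤ => (fun i => (u i : ℝ) : V n))).subset ?_
  rintro β ⟨⟨w, hw, i, rfl⟩, hβ⟩
  obtain ⟨u, hu⟩ := int_W S w hw (Pi.single i 1)
  have hα : (fun j => (((Pi.single i 1 : Fin n → ℤ) j : ℤ) : ℝ)) = α i := by
    ext j
    by_cases hj : j = i <;> simp [α, Pi.single_apply, hj]
  rw [hα] at hu
  have h1 := hm _ hβ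
  rw [K_W S w hw] at h1
  have h2 : S.K (α i) (α i) ≤ C :=
    Finset.single_le_sum (f := fun i => S.K (α i) (α i)) (fun i _ => h _) (Finset.mem_univ i)
  have h3 : ‖w (α i)‖ ^ 2 ≤ C / m := by rw [le_div_iff₀ hm0]; linarith
  have h4 : ‖w (α i)‖ ≤ N := by nlinarith [sq_nonneg (‖w (α i)‖ - 1)]
  have h5 : ∀ j, |u j| ≤ N := by
    intro j
    have := (norm_le_pi_norm (w (α i)) j).trans h4
    rw [hu, Real.norm_eq_abs] at this
    beta_reduce at this
    exact_mod_cast this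
  exact ⟨u, ⟨fun j => (abs_le.mp (h5 j)).1, fun j => (abs_le.mp (h5 j)).2⟩, hu.symm⟩

theorem omega_alpha (l : List (Fin n)) (i : Fin n) (y : V n) :
    S.omega l (α i) y = ∑ q, S.omegaEntry l i q * y q := by
  rw [Setup.omega, Finset.sum_eq_single i]
  · simp [α]
  · intro p _ hp
    simp [α, Pi.single_apply, hp]
  · simp

theorem pairing_omegaFun (l : List (Fin n)) (δ v : V n) :
    pairing (S.omegaFun l δ) v = S.omega l v δ := by
  simp only [pairing, Setup.omegaFun, omega_alpha]
  simp only [Setup.omega, Finset.sum_mul]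
  refine Finset.sum_congr rfl fun p _ => Finset.sum_congr rfl fun q _ => by ring

theorem pairing_neg (x v : V n) : pairing (-x) v = - pairing x v := by
  simp [pairing]

theorem pairing_neg_right (x v : V n) : pairing x (-v) = - pairing x v := by
  simp [pairing]

theorem omegaEntry_skew (l : List (Fin n)) (p q : Fin n) :
    S.omegaEntry l p q = - S.omegaEntry l q p := by
  have := S.dsymm p q
  unfold Setup.omegaEntry
  split_ifs <;> first | omega | simp [this]

theorem omega_self (l : List (Fin n)) (v : V n) : S.omega l v v = 0 := by
  have h : S.omega l v v = - S.omega l v v := by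
    conv_lhs => rw [Setup.omega, Finset.sum_comm]
    rw [Setup.omega, ← Finset.sum_neg_distrib]
    refine Finset.sum_congr rfl fun p _ => ?_
    rw [← Finset.sum_neg_distrib]
    refine Finset.sum_congr rfl fun q _ => ?_
    rw [omegaEntry_skew]; ring
  linarith

theorem omega_ne (δ : V n) (hδ : S.IsDelta δ) (aff : Fin n)
    (l : List (Fin n)) (hl : l.toFinset = Finset.univ) : ∃ i, S.omega l (α i) δ ≠ 0 := by
  have hmem : ∀ i, i ∈ l := fun i => by rw [← List.mem_toFinset, hl]; simp
  obtain ⟨i, t, rfl⟩ : ∃ i t, l = i :: t := List.exists_cons_of_ne_nil (List.ne_nil_of_mem (hmem aff))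
  refine ⟨i, ?_⟩
  have h1 : S.omega (i :: t) (α i) δ + S.K (α i) δ = 2 * S.d i * δ i := by
    rw [omega_alpha, K_alpha, coefL_apply, Finset.mul_sum, ← Finset.sum_add_distrib,
      Finset.sum_eq_single i]
    · simp [Setup.omegaEntry, S.diag]; ring
    · intro q _ hq
      have : (i :: t).idxOf q ≠ 0 := by
        rw [List.idxOf_cons_ne _ (Ne.symm hq)]; simp
      simp [Setup.omegaEntry, Nat.pos_of_ne_zero this]
      ring
    · simp
  rw [K_symm, hδ.1, add_zero] at h1
  obtain ⟨m, hm, hmp, -⟩ := hδ.2.1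
  have : 0 < δ i := by rw [hm]; exact_mod_cast hmp i
  have := S.d_pos i
  rw [h1]; positivity

end Helpers

/-- in affine type, the imaginary wall `(d_∞, f_∞)` is gregarious and
outgoing: `−ω_c(·,δ)` lies in the relative interior of `d_∞`, and `ω_c(·,δ) ∉ d_∞`. -/
theorem statement13 {n : ℕ} (S : Setup n) (haff : S.AffineType)
    (δ : V n) (hδ : S.IsDelta δ) (aff : Fin n) (haffidx : S.IsAffIndex δ aff)
    (l : List (Fin n)) (c : Module.End ℝ (V n)) (hc : S.IsCoxWord l c) :
    -(S.omegaFun l δ) ∈ relint (S.dInf l δ aff) ∧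
    S.omegaFun l δ ∉ S.dInf l δ aff := by
  constructor
  · have hfin := fin_roots S haff.1 δ hδ aff
    set F : Set (V n) := {β | (β ∈ S.realRoots ∧ β aff = 0) ∧ 0 < S.omega l β δ} with hF
    have hFfin : F.Finite := hfin.subset fun β hβ => hβ.1
    have hcont : ∀ β : V n, Continuous fun x : V n => pairing x β := by
      intro β; unfold pairing; fun_prop
    have hspan : ∀ x ∈ Submodule.span ℝ (S.dInf l δ aff), pairing x δ = 0 := by
      intro x hx
      induction hx using Submodule.span_induction with
      | mem x hx => exact hx.1
      | zero => simp [pairing]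
      | add x y _ _ hx hy =>
        have : pairing (x + y) δ = pairing x δ + pairing y δ := by
          simp [pairing, add_mul, Finset.sum_add_distrib]
        rw [this, hx, hy, add_zero]
      | smul a x _ hx =>
        have : pairing (a • x) δ = a * pairing x δ := by
          simp [pairing, Finset.mul_sum, mul_assoc]
        rw [this, hx, mul_zero]
    have hx0 : -(S.omegaFun l δ) ∈ S.dInf l δ aff := by
      refine ⟨by rw [pairing_neg, pairing_omegaFun, omega_self, neg_zero], ?_⟩
      intro β _ _ h
      rw [pairing_neg, pairing_omegaFun]; linarith
    have hopen : IsOpen {x : V n | ∀ β ∈ F, pairing x β < 0} := by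
      have : {x : V n | ∀ β ∈ F, pairing x β < 0} = ⋂ β ∈ F, {x | pairing x β < 0} := by
        ext; simp
      rw [this]
      exact hFfin.isOpen_biInter fun β _ => isOpen_lt (hcont β) continuous_const
    refine ⟨⟨_, Submodule.subset_span hx0⟩, ?_, rfl⟩
    rw [mem_interior]
    refine ⟨_, ?_, hopen.preimage continuous_subtype_val, ?_⟩
    · intro x hx
      exact ⟨hspan x x.2, fun β h1 h2 h3 => (hx β ⟨⟨h1, h2⟩, h3⟩).le⟩
    · intro β hβ
      have := hβ.2
      change pairing (-(S.omegaFun l δ)) β < 0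
      rw [pairing_neg, pairing_omegaFun]; linarith
  · rintro ⟨-, h⟩
    obtain ⟨i, hi⟩ := omega_ne S δ hδ aff l hc.2.1
    have hz : ∀ j, j ≠ aff → S.omega l (α j) δ = 0 := by
      intro j hj
      have hr1 : α j ∈ S.realRoots := ⟨1, S.W.one_mem, j, rfl⟩
      have hr2 : -(α j : V n) ∈ S.realRoots :=
        ⟨S.sRefl j, Submonoid.subset_closure ⟨j, rfl⟩, j, by
          rw [sRefl_apply, coefL_alpha, neg_smul, two_smul]; abel⟩
      have ha : (α j : V n) aff = 0 := by simp [α, hj.symm]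
      have h1 := h _ hr1 ha
      have h2 := h _ hr2 (by simp [ha])
      rw [← pairing_omegaFun] at h1 h2 ⊢
      rw [pairing_neg_right] at h2
      by_contra hne
      rcases lt_or_gt_of_ne hne with h' | h'
      · linarith [h2 (by linarith)]
      · linarith [h1 h']
    have hself := omega_self S l δ
    rw [← pairing_omegaFun, pairing, Finset.sum_eq_single aff] at hself
    · obtain ⟨m, hm, hmp, -⟩ := hδ.2.1
      have hp : δ aff ≠ 0 := by rw [hm]; exact_mod_cast (hmp aff).ne'
      have h0 : S.omega l (α aff) δ = 0 := by
        simpa [hp, Setup.omegaFun] using hself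
      by_cases hia : i = aff
      · exact hi (hia ▸ h0)
      · exact hi (hz i hia)
    · intro j _ hj
      simp [Setup.omegaFun, hz j hj]
    · simp

end PaperScat

end
end

section
/- Let B be an n×n skew-symmetrizable integer exchange matrix and let ℓ ∈ {1,…,n}. Then the mutation fan F_B refines the fan Proj_⟨ℓ⟩^{-1}(F_{B_⟨ℓ⟩}); equivalently, if x_1 ≡^B x_2 for x_1, x_2 ∈ ℝ^n, then Proj_⟨ℓ⟩(x_1) ≡^{B_⟨ℓ⟩} Proj_⟨ℓ⟩(x_2), and consequently every cone of F_B is contained in Proj_⟨ℓ⟩^{-1}(C) for some cone C of F_{B_⟨ℓ⟩}. -/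
noncomputable section

namespace MutFan

variable {ι : Type*} [Fintype ι] [DecidableEq ι]

/-- Matrix mutation `μ_k` of an exchange matrix. -/
def mutMat (B : Matrix ι ι ℤ) (k : ι) : Matrix ι ι ℤ :=
  Matrix.of fun i j =>
    if i = k ∨ j = k then -B i j
    else B i j + Int.sign (B k j) * max (B i k * B k j) 0

/-- Mutation of an appended real coefficient row. -/
def mutRow (B : Matrix ι ι ℤ) (k : ι) (x : ι → ℝ) : ι → ℝ :=
  fun j => if j = k then -x j
    else x j + (Int.sign (B k j) : ℝ) * max (x k * (B k j : ℝ)) 0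

/-- `μ_k(B)` for a finite sequence `k = k_q, …, k_1` of indices (the list
`[k_q, …, k_1]`, applied right-to-left). -/
def mutSeq (B : Matrix ι ι ℤ) : List ι → Matrix ι ι ℤ
  | [] => B
  | k :: ks => mutMat (mutSeq B ks) k

/-- The mutation map `η_k^B : ℝ^ι → ℝ^ι`. -/
def etaSeq (B : Matrix ι ι ℤ) : List ι → (ι → ℝ) → ι → ℝ
  | [], x => x
  | k :: ks, x => mutRow (mutSeq B ks) k (etaSeq B ks x)

/-- `B`-equivalence: the sign vectors of `η_k^B(x)` and `η_k^B(y)` agree for every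
finite sequence `k` of indices. -/
def BEquiv (B : Matrix ι ι ℤ) (x y : ι → ℝ) : Prop :=
  ∀ (ks : List ι) (j : ι), Real.sign (etaSeq B ks x j) = Real.sign (etaSeq B ks y j)

/-- `B`-cones: closures of `B`-equivalence classes. -/
def IsBCone (B : Matrix ι ι ℤ) (C : Set (ι → ℝ)) : Prop :=
  ∃ x : ι → ℝ, C = closure {y | BEquiv B x y}

/-- `F` is a face of the convex cone `C`. -/
def IsFaceOf (F C : Set (ι → ℝ)) : Prop :=
  F ⊆ C ∧ ∀ x ∈ C, ∀ y ∈ C, ∀ z ∈ F, z ∈ segment ℝ x y → z ≠ x → z ≠ y → segment ℝ x y ⊆ F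

/-- The cones of the mutation fan `F_B`: the `B`-cones and their faces. -/
def IsMutFanCone (B : Matrix ι ι ℤ) (C : Set (ι → ℝ)) : Prop :=
  ∃ D, IsBCone B D ∧ IsFaceOf C D

end MutFan

open MutFan

namespace MutFan

theorem mutSeq_del {n : ℕ} (B : Matrix (Fin n) (Fin n) ℤ) (ℓ : Fin n)
    (ks : List {j : Fin n // j ≠ ℓ}) (i j : {j : Fin n // j ≠ ℓ}) :
    mutSeq (Matrix.of fun i j : {j : Fin n // j ≠ ℓ} => B i.1 j.1) ks i j
      = mutSeq B (ks.map Subtype.val) i.1 j.1 := by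
  induction ks generalizing i j with
  | nil => rfl
  | cons k ks ih => simp [mutSeq, mutMat, ih, Subtype.ext_iff]

theorem etaSeq_del {n : ℕ} (B : Matrix (Fin n) (Fin n) ℤ) (ℓ : Fin n)
    (x : Fin n → ℝ) (ks : List {j : Fin n // j ≠ ℓ}) (j : {j : Fin n // j ≠ ℓ}) :
    etaSeq (Matrix.of fun i j : {j : Fin n // j ≠ ℓ} => B i.1 j.1) ks (fun i => x i.1) j
      = etaSeq B (ks.map Subtype.val) x j.1 := by
  induction ks generalizing j with
  | nil => rfl
  | cons k ks ih => simp [etaSeq, mutRow, ih, mutSeq_del, Subtype.ext_iff]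

theorem sign_cases {u v : ℝ} (h : Real.sign u = Real.sign v) :
    (0 < u ∧ 0 < v) ∨ (u = 0 ∧ v = 0) ∨ (u < 0 ∧ v < 0) := by
  rcases lt_trichotomy u 0 with hu | hu | hu <;> rcases lt_trichotomy v 0 with hv | hv | hv <;>
    simp_all [Real.sign_of_neg, Real.sign_of_pos] <;> norm_num at h

theorem sign_comb {u v a b : ℝ} (ha : 0 ≤ a) (hb : 0 ≤ b) (hab : a + b = 1)
    (h : Real.sign u = Real.sign v) : Real.sign u = Real.sign (a * u + b * v) := by
  have hb' : b = 1 - a := by linarith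
  rcases sign_cases h with ⟨h1, h2⟩ | ⟨h1, h2⟩ | ⟨h1, h2⟩
  · have : 0 < a * u + b * v := by
      rcases ha.eq_or_lt with rfl | ha
      · have : b = 1 := by linarith
        subst this; linarith
      · have := mul_pos ha h1
        have := mul_nonneg hb h2.le
        linarith
    rw [Real.sign_of_pos h1, Real.sign_of_pos this]
  · simp [h1, h2]
  · have : a * u + b * v < 0 := by
      rcases ha.eq_or_lt with rfl | ha
      · have : b = 1 := by linarith
        subst this; linarith
      · have := mul_neg_of_pos_of_neg ha h1
        have := mul_nonpos_of_nonneg_of_nonpos hb h2.le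
        linarith
    rw [Real.sign_of_neg h1, Real.sign_of_neg this]

theorem max_comb {u v a b c : ℝ} (ha : 0 ≤ a) (hb : 0 ≤ b)
    (h : Real.sign u = Real.sign v) :
    max ((a * u + b * v) * c) 0 = a * max (u * c) 0 + b * max (v * c) 0 := by
  have key : (0 ≤ u * c ∧ 0 ≤ v * c) ∨ (u * c ≤ 0 ∧ v * c ≤ 0) := by
    rcases sign_cases h with ⟨h1, h2⟩ | ⟨h1, h2⟩ | ⟨h1, h2⟩
    · rcases le_total 0 c with hc | hc
      · exact Or.inl ⟨mul_nonneg h1.le hc, mul_nonneg h2.le hc⟩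
      · exact Or.inr ⟨mul_nonpos_of_nonneg_of_nonpos h1.le hc,
          mul_nonpos_of_nonneg_of_nonpos h2.le hc⟩
    · simp [h1, h2]
    · rcases le_total 0 c with hc | hc
      · exact Or.inr ⟨mul_nonpos_of_nonpos_of_nonneg h1.le hc,
          mul_nonpos_of_nonpos_of_nonneg h2.le hc⟩
      · exact Or.inl ⟨mul_nonneg_of_nonpos_of_nonpos h1.le hc,
          mul_nonneg_of_nonpos_of_nonpos h2.le hc⟩
  have e : (a * u + b * v) * c = a * (u * c) + b * (v * c) := by ring
  rw [e]
  rcases key with ⟨h1, h2⟩ | ⟨h1, h2⟩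
  · rw [max_eq_left h1, max_eq_left h2, max_eq_left (by positivity)]
  · rw [max_eq_right h1, max_eq_right h2, max_eq_right]
    · ring
    · have := mul_nonpos_of_nonneg_of_nonpos ha h1
      have := mul_nonpos_of_nonneg_of_nonpos hb h2
      linarith

theorem etaSeq_comb {ι : Type*} [Fintype ι] [DecidableEq ι] (B : Matrix ι ι ℤ) {x y : ι → ℝ}
    (h : BEquiv B x y) {a b : ℝ} (ha : 0 ≤ a) (hb : 0 ≤ b) (ks : List ι) (j : ι) :
    etaSeq B ks (a • x + b • y) j = a * etaSeq B ks x j + b * etaSeq B ks y j := by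
  induction ks generalizing j with
  | nil => simp [etaSeq]
  | cons k ks ih =>
    simp only [etaSeq, mutRow, ih]
    split_ifs
    · ring
    · rw [max_comb ha hb (h ks k)]; ring

theorem convex_class {ι : Type*} [Fintype ι] [DecidableEq ι] (B : Matrix ι ι ℤ) (x : ι → ℝ) :
    Convex ℝ {y | BEquiv B x y} := by
  intro y hy z hz a b ha hb hab ks j
  have hyz : BEquiv B y z := fun ks j => (hy ks j).symm.trans (hz ks j)
  rw [etaSeq_comb B hyz ha hb, hy ks j]
  exact sign_comb ha hb hab (hyz ks j)

end MutFan

/-- the mutation fan `F_B` refines `Proj_⟨ℓ⟩⁻¹(F_{B_⟨ℓ⟩})`: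
`B`-equivalent points project to `B_⟨ℓ⟩`-equivalent points, and consequently every cone
of `F_B` is contained in `Proj_⟨ℓ⟩⁻¹(C)` for some cone `C` of `F_{B_⟨ℓ⟩}`. -/
theorem statement19 {n : ℕ} (B : Matrix (Fin n) (Fin n) ℤ)
    (hskew : ∃ d : Fin n → ℝ, (∀ i, 0 < d i) ∧
      ∀ i j, d i * (B i j : ℝ) = -(d j * (B j i : ℝ)))
    (ℓ : Fin n)
    (Bdel : Matrix {j : Fin n // j ≠ ℓ} {j : Fin n // j ≠ ℓ} ℤ)
    (hBdel : Bdel = Matrix.of fun i j => B i.1 j.1)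
    (proj : (Fin n → ℝ) → ({j : Fin n // j ≠ ℓ} → ℝ))
    (hproj : proj = fun x i => x i.1) :
    (∀ x y : Fin n → ℝ, BEquiv B x y → BEquiv Bdel (proj x) (proj y)) ∧
    (∀ C : Set (Fin n → ℝ), IsMutFanCone B C →
      ∃ C', IsMutFanCone Bdel C' ∧ C ⊆ proj ⁻¹' C') := by
  subst hBdel hproj
  have h1 : ∀ x y : Fin n → ℝ, BEquiv B x y →
      BEquiv (Matrix.of fun i j : {j : Fin n // j ≠ ℓ} => B i.1 j.1)
        (fun i => x i.1) (fun i => y i.1) := by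
    intro x y h ks j
    rw [etaSeq_del, etaSeq_del]
    exact h _ _
  refine ⟨h1, ?_⟩
  rintro C ⟨D, ⟨x, rfl⟩, hC, -⟩
  refine ⟨_, ⟨_, ⟨fun i => x i.1, rfl⟩, subset_rfl, ?_⟩, ?_⟩
  · intro u hu v hv _ _ _ _ _
    exact (convex_class _ _).closure.segment_subset hu hv
  · intro y hy
    have hc : Continuous (fun (x : Fin n → ℝ) (i : {j : Fin n // j ≠ ℓ}) => x i.1) := by fun_prop
    exact map_mem_closure hc (hC hy) (fun z hz => h1 x z hz)

end
end
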